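/- Let D : Fin m → ℝ consist of m/2 values +1 and m/2 values -1 (m even). For the uniformly random ordering, the expectation of max_{1≤k≤m} |∑_{j=1}^k D(j)| / sqrt(m) converges to sqrt(π/2)·ln 2 as m → ∞. -/

import Mathlib

noncomputable def ks (m : ℕ) (D : Fin m → ℝ) : ℝ :=
  (Finset.range (m + 1)).sup' (by simp) fun k => |∑ j : Fin m, if (j : ℕ) < k then D j else 0|

/-- The position after `k` steps of the walk started at the origin with up-steps given by `s`. -/
def walk {n : ℕ} (s : Fin n → Bool) (k : ℕ) : ℤ :=
  ∑ j : Fin n, if (j : ℕ) < k then (if s j then 1 else -1) else 0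

theorem walk_zero {n : ℕ} (s : Fin n → Bool) : walk s 0 = 0 := by simp [walk]

theorem walk_cons_succ {n : ℕ} (b : Bool) (s : Fin n → Bool) (k : ℕ) :
    walk (Fin.cons b s : Fin (n + 1) → Bool) (k + 1) = (if b then 1 else -1) + walk s k := by
  simp [walk, Fin.sum_univ_succ]

theorem abs_walk_le {n : ℕ} (s : Fin n → Bool) (k : ℕ) : |walk s k| ≤ n := by
  refine (Finset.abs_sum_le_sum_abs _ _).trans ?_
  refine (Finset.sum_le_card_nsmul _ _ 1 fun j _ => ?_).trans (by simp)
  split_ifs <;> simp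

/-- The walk of length `n` started at `x` ends at the origin. -/
def IsBridgeFrom {n : ℕ} (x : ℤ) (s : Fin n → Bool) : Prop := x + walk s n = 0

instance {n : ℕ} (x : ℤ) : DecidablePred (IsBridgeFrom (n := n) x) :=
  fun _ => inferInstanceAs (Decidable (_ = _))

/-- The walk of length `n` started at `x` ends at the origin and stays in `(-a, a)`. -/
def IsConfined (a : ℤ) {n : ℕ} (x : ℤ) (s : Fin n → Bool) : Prop :=
  IsBridgeFrom x s ∧ ∀ k ∈ Finset.range (n + 1), |x + walk s k| < a

instance (a : ℤ) {n : ℕ} (x : ℤ) : DecidablePred (IsConfined (n := n) a x) :=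
  fun _ => inferInstanceAs (Decidable (_ ∧ _))

theorem isConfined_cons {n : ℕ} (a x : ℤ) (b : Bool) (s : Fin n → Bool) :
    IsConfined a x (Fin.cons b s : Fin (n + 1) → Bool) ↔
      |x| < a ∧ IsConfined a (x + if b then 1 else -1) s := by
  unfold IsConfined IsBridgeFrom
  rw [walk_cons_succ]
  simp only [Finset.mem_range]
  constructor
  · rintro ⟨h, hk⟩
    refine ⟨by simpa [walk_zero] using hk 0 (by omega), by rw [← h]; ring, fun k hkn => ?_⟩
    have := hk (k + 1) (by omega)
    rwa [walk_cons_succ, ← add_assoc] at this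
  · rintro ⟨hx, h, hk⟩
    refine ⟨by rw [← h]; ring, fun k hkn => ?_⟩
    cases k with
    | zero => simpa [walk_zero] using hx
    | succ k =>
      rw [walk_cons_succ, ← add_assoc]
      exact hk k (by omega)

/-- The number of walks of length `n` from `x` to the origin that stay in `(-a, a)`. -/
def confinedCount (a : ℤ) (n : ℕ) (x : ℤ) : ℤ :=
  ∑ s : Fin n → Bool, if IsConfined a x s then 1 else 0

theorem confinedCount_zero (a : ℤ) (ha : 0 < a) (x : ℤ) :
    confinedCount a 0 x = if x = 0 then 1 else 0 := by
  rw [confinedCount, Fintype.sum_unique]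
  congr 1
  simp only [IsConfined, IsBridgeFrom, eq_iff_iff]
  simp only [walk_zero, zero_add, Finset.range_one, Finset.mem_singleton, forall_eq, add_zero]
  constructor
  · exact fun h => h.1
  · rintro rfl
    simpa using ha

theorem confinedCount_succ (a : ℤ) (n : ℕ) (x : ℤ) :
    confinedCount a (n + 1) x =
      if |x| < a then confinedCount a n (x + 1) + confinedCount a n (x - 1) else 0 := by
  simp only [confinedCount]
  rw [← (Fin.consEquiv fun _ : Fin (n + 1) => Bool).sum_comp, Fintype.sum_prod_type]
  have hcons (b : Bool) (s : Fin n → Bool) :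
      IsConfined a x (Fin.consEquiv (fun _ : Fin (n + 1) => Bool) (b, s)) ↔
        |x| < a ∧ IsConfined a (x + if b then 1 else -1) s := isConfined_cons a x b s
  simp only [hcons, Fintype.univ_bool]
  split_ifs with h
  · simp [h, sub_eq_add_neg]
  · simp [h]

/-- The signed count of images of the origin under reflections in `a` and `-a`, with `b = 2 * a`:
`(-1) ^ j` at `j * b` and zero elsewhere. -/
def imageWeight (b l : ℤ) : ℤ := (if 2 * b ∣ l then 1 else 0) - if 2 * b ∣ l + b then 1 else 0

theorem imageWeight_add (b l : ℤ) : imageWeight b (l + b) = -imageWeight b l := by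
  have h : 2 * b ∣ l + b + b ↔ 2 * b ∣ l := by
    rw [show l + b + b = l + 2 * b by ring, dvd_add_self_right]
  simp only [imageWeight, h]
  ring

theorem imageWeight_neg (b l : ℤ) : imageWeight b (-l) = imageWeight b l := by
  have h : 2 * b ∣ -l + b ↔ 2 * b ∣ l + b := by
    rw [← dvd_neg, ← dvd_add_self_right]
    ring_nf
  simp only [imageWeight, h, dvd_neg]

theorem imageWeight_mul_add (b l : ℤ) (k : ℕ) :
    imageWeight b (k * b + l) = (-1) ^ k * imageWeight b l := by
  induction k with
  | zero => simp
  | succ k ih =>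
    rw [show ((k + 1 : ℕ) : ℤ) * b + l = k * b + l + b by push_cast; ring, imageWeight_add, ih]
    ring

theorem imageWeight_eq_zero {b l : ℤ} (h0 : 0 < l) (hb : l < b) : imageWeight b l = 0 := by
  have h1 : ¬ 2 * b ∣ l := fun h => by have := Int.le_of_dvd h0 h; omega
  have h2 : ¬ 2 * b ∣ l + b := fun h => by have := Int.le_of_dvd (by omega) h; omega
  simp [imageWeight, h1, h2]

theorem imageWeight_zero {b : ℤ} (hb : 0 < b) : imageWeight b 0 = 1 := by
  have h2 : ¬ 2 * b ∣ b := fun h => by have := Int.le_of_dvd (by omega) h; omega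
  simp [imageWeight, h2]

theorem imageWeight_self {b : ℤ} (hb : 0 < b) : imageWeight b b = -1 := by
  simpa [imageWeight_zero hb] using imageWeight_add b 0

theorem imageWeight_two_mul (b l : ℤ) : imageWeight (2 * b) (2 * l) = imageWeight b l := by
  have h1 : 2 * (2 * b) ∣ 2 * l ↔ 2 * b ∣ l := mul_dvd_mul_iff_left two_ne_zero
  have h2 : 2 * (2 * b) ∣ 2 * l + 2 * b ↔ 2 * b ∣ l + b := by
    rw [← mul_add]; exact mul_dvd_mul_iff_left two_ne_zero
  simp only [imageWeight, h1, h2]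

/-- The signed count of unrestricted walks of length `n` from `x` to the images of the origin. -/
def imageCount (a : ℤ) : ℕ → ℤ → ℤ
  | 0, x => imageWeight (2 * a) x
  | n + 1, x => imageCount a n (x + 1) + imageCount a n (x - 1)

theorem imageCount_add (a : ℤ) (n : ℕ) (x : ℤ) :
    imageCount a n (x + 2 * a) = -imageCount a n x := by
  induction n generalizing x with
  | zero => exact imageWeight_add _ _
  | succ n ih =>
    simp only [imageCount]
    rw [add_right_comm, ih, add_sub_right_comm, ih]
    ring

theorem imageCount_neg (a : ℤ) (n : ℕ) (x : ℤ) : imageCount a n (-x) = imageCount a n x := by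
  induction n generalizing x with
  | zero => exact imageWeight_neg _ _
  | succ n ih =>
    simp only [imageCount]
    rw [show -x + 1 = -(x - 1) by ring, show -x - 1 = -(x + 1) by ring, ih, ih]
    ring

theorem imageCount_boundary (a : ℤ) (n : ℕ) : imageCount a n a = 0 := by
  have h := imageCount_add a n (-a)
  rw [imageCount_neg, show -a + 2 * a = a by ring] at h
  omega

theorem confinedCount_eq_imageCount {a : ℤ} (ha : 0 < a) (n : ℕ) {x : ℤ} (hx : |x| ≤ a) :
    confinedCount a n x = imageCount a n x := by
  induction n generalizing x with
  | zero =>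
    rw [confinedCount_zero a ha, imageCount]
    rcases lt_trichotomy x 0 with h | h | h
    · rw [if_neg h.ne, ← imageWeight_neg, imageWeight_eq_zero] <;> grind
    · simp [h, imageWeight_zero, ha]
    · rw [if_neg h.ne', imageWeight_eq_zero] <;> grind
  | succ n ih =>
    rw [confinedCount_succ]
    split_ifs with h
    · rw [imageCount, ih, ih] <;> grind
    · rcases abs_choice x with h' | h'
      · rw [show x = a by omega, imageCount_boundary]
      · rw [show x = -a by omega, imageCount_neg, imageCount_boundary]

theorem imageCount_eq_sum (a : ℤ) (n : ℕ) (x : ℤ) :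
    imageCount a n x = ∑ i ∈ Finset.range (n + 1),
      (n.choose i : ℤ) * imageWeight (2 * a) (x + i - (n - i : ℕ)) := by
  induction n generalizing x with
  | zero => simp [imageCount]
  | succ n ih =>
    rw [imageCount, ih, ih,
      Finset.sum_choose_succ_mul (fun i j => imageWeight (2 * a) (x + i - (j : ℕ))) n, add_comm]
    congr 1 <;> refine Finset.sum_congr rfl fun i hi => ?_
    · have : i ≤ n := by simpa [Nat.lt_succ_iff] using hi
      congr 2
      push_cast [this, Nat.le_succ_of_le this]
      ring
    · congr 2
      push_cast
      ring

theorem imageCount_two_mul (a : ℤ) (ha : 0 < a) (m : ℕ) :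
    imageCount a (2 * m) 0 = (2 * m).choose m +
      2 * ∑ n ∈ Finset.range m, ((2 * m).choose (m + (n + 1)) : ℤ) * imageWeight a (n + 1) := by
  rw [imageCount_eq_sum, show 2 * m + 1 = m + (m + 1) by ring, Finset.sum_range_add,
    Finset.sum_range_succ', ← Finset.sum_range_reflect]
  have h1 : ∀ n ∈ Finset.range m, ((2 * m).choose (m - 1 - n) : ℤ) *
      imageWeight (2 * a) (0 + (m - 1 - n : ℕ) - (2 * m - (m - 1 - n) : ℕ)) =
      ((2 * m).choose (m + (n + 1)) : ℤ) * imageWeight a (n + 1) := by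
    intro n hn
    have hn : n < m := by simpa using hn
    rw [← Nat.choose_symm (by omega), ← imageWeight_neg, ← imageWeight_two_mul a (n + 1)]
    congr 3 <;> omega
  have h2 : ∀ n ∈ Finset.range m, ((2 * m).choose (m + (n + 1)) : ℤ) *
      imageWeight (2 * a) (0 + (m + (n + 1) : ℕ) - (2 * m - (m + (n + 1)) : ℕ)) =
      ((2 * m).choose (m + (n + 1)) : ℤ) * imageWeight a (n + 1) := by
    intro n hn
    have hn : n < m := by simpa using hn
    rw [← imageWeight_two_mul a (n + 1)]
    congr 2
    omega
  rw [Finset.sum_congr rfl h1, Finset.sum_congr rfl h2]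
  have h3 : (0 + (m + 0 : ℕ) - (2 * m - (m + 0) : ℕ) : ℤ) = 0 := by omega
  rw [h3, imageWeight_zero (by omega)]
  simp only [add_zero]
  ring

theorem sum_mul_imageWeight {a : ℕ} (ha : 0 < a) (f : ℕ → ℤ) (K : ℕ) :
    ∑ n ∈ Finset.range (K * a), f (n + 1) * imageWeight a (n + 1) =
      -∑ k ∈ Finset.range K, (-1) ^ k * f ((k + 1) * a) := by
  induction K with
  | zero => simp
  | succ K ih =>
    rw [Nat.succ_mul, Finset.sum_range_add, ih, Finset.sum_range_succ, neg_add]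
    congr 1
    obtain ⟨c, rfl⟩ : ∃ c, a = c + 1 := ⟨a - 1, by omega⟩
    have h (j : ℕ) : imageWeight (c + 1 : ℕ) ((K * (c + 1) + j : ℕ) + 1) =
        (-1) ^ K * imageWeight (c + 1 : ℕ) (j + 1) := by
      rw [← imageWeight_mul_add]
      push_cast
      ring_nf
    simp only [h]
    rw [Finset.sum_range_succ, Finset.sum_eq_zero, zero_add]
    · rw [show ((c : ℤ) + 1) = (c + 1 : ℕ) by simp, imageWeight_self (by positivity)]
      rw [show (K + 1) * (c + 1) = K * (c + 1) + c + 1 by ring]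
      ring
    · intro j hj
      have hj : j < c := by simpa using hj
      rw [imageWeight_eq_zero (by positivity) (by push_cast; omega)]
      simp

theorem confinedCount_bridge {a : ℕ} (ha : 0 < a) (m : ℕ) :
    confinedCount a (2 * m) 0 = (2 * m).choose m -
      2 * ∑ k ∈ Finset.range m, (-1) ^ k * ((2 * m).choose (m + (k + 1) * a) : ℤ) := by
  rw [confinedCount_eq_imageCount (by exact_mod_cast ha) _ (by simp),
    imageCount_two_mul _ (by exact_mod_cast ha)]
  have h := sum_mul_imageWeight ha (fun n => ((2 * m).choose (m + n) : ℤ)) m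
  rw [← Finset.sum_subset (Finset.range_mono (Nat.le_mul_of_pos_right m ha))] at h
  · rw [h]
    ring
  · intro n _ hn
    have hn : m ≤ n := by simpa using hn
    simp [Nat.choose_eq_zero_of_lt (show 2 * m < m + (n + 1) by omega)]

/-- The maximal distance of the walk from the origin. -/
def maxWalk {n : ℕ} (s : Fin n → Bool) : ℕ :=
  (Finset.range (n + 1)).sup fun k => (walk s k).natAbs

theorem maxWalk_lt_iff {n : ℕ} (s : Fin n → Bool) {a : ℕ} (ha : 0 < a) :
    maxWalk s < a ↔ ∀ k ∈ Finset.range (n + 1), |walk s k| < a := by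
  rw [maxWalk, Finset.sup_lt_iff (by simpa using ha)]
  refine forall₂_congr fun k _ => ?_
  rw [Int.abs_eq_natAbs]
  norm_cast

theorem maxWalk_le {n : ℕ} (s : Fin n → Bool) : maxWalk s ≤ n := by
  rw [← Nat.lt_succ_iff, maxWalk_lt_iff s (Nat.succ_pos n)]
  intro k _
  have := abs_walk_le s k
  push_cast
  omega

theorem ks_eq_maxWalk {n : ℕ} (s : Fin n → Bool) :
    ks n (fun j => if s j then 1 else -1) = maxWalk s := by
  have h (k : ℕ) : |∑ j : Fin n, if (j : ℕ) < k then (if s j then (1 : ℝ) else -1) else 0| =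
      ((walk s k).natAbs : ℝ) := by
    rw [Nat.cast_natAbs, Int.cast_abs, walk]
    push_cast
    rfl
  unfold ks
  simp only [h]
  rw [maxWalk, ← Finset.sup'_eq_sup (by simp)]
  exact (Finset.apply_sup'_eq_sup'_comp (s := Finset.range (n + 1)) (by simp)
    (f := fun k => (walk s k).natAbs) (Nat.cast : ℕ → ℝ) (fun _ _ => Nat.cast_max _ _)).symm

theorem isConfined_zero_iff {n : ℕ} (s : Fin n → Bool) {a : ℕ} (ha : 0 < a) :
    IsConfined a 0 s ↔ IsBridgeFrom 0 s ∧ maxWalk s < a := by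
  rw [maxWalk_lt_iff s ha, IsConfined]
  simp only [zero_add]

theorem card_bridge (m : ℕ) :
    (Finset.univ.filter fun s : Fin (2 * m) → Bool => IsBridgeFrom 0 s).card = (2 * m).choose m := by
  have h := confinedCount_bridge (Nat.succ_pos (2 * m)) m
  rw [Finset.sum_eq_zero, mul_zero, sub_zero, confinedCount] at h
  · simp only [isConfined_zero_iff _ (Nat.succ_pos (2 * m)), Nat.lt_succ_iff, maxWalk_le, and_true,
      Finset.sum_boole] at h
    exact_mod_cast h
  · intro k _
    have : 2 * m < m + (k + 1) * (2 * m).succ := by nlinarith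
    simp [Nat.choose_eq_zero_of_lt this]

theorem sum_maxWalk_bridge (m : ℕ) :
    ∑ s : Fin (2 * m) → Bool with IsBridgeFrom 0 s, (maxWalk s : ℤ) =
      2 * ∑ k ∈ Finset.range m, (-1) ^ k *
        ∑ a ∈ Finset.range (2 * m), ((2 * m).choose (m + (k + 1) * (a + 1)) : ℤ) := by
  have h1 (s : Fin (2 * m) → Bool) :
      (maxWalk s : ℤ) = ∑ a ∈ Finset.range (2 * m), (1 - if maxWalk s < a + 1 then 1 else 0) := by
    have h : ∀ a, (1 - if maxWalk s < a + 1 then 1 else 0 : ℤ) = if a < maxWalk s then 1 else 0 := by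
      intro a
      split_ifs <;> omega
    simp only [h, Finset.sum_boole]
    congr 1
    have : (Finset.range (2 * m)).filter (fun a => a < maxWalk s) = Finset.range (maxWalk s) := by
      ext a
      have := maxWalk_le s
      simp only [Finset.mem_filter, Finset.mem_range]
      omega
    rw [this, Finset.card_range]
  have h2 (a : ℕ) : ∑ s : Fin (2 * m) → Bool with IsBridgeFrom 0 s,
      (1 - if maxWalk s < a + 1 then 1 else 0 : ℤ) =
      2 * ∑ k ∈ Finset.range m, (-1) ^ k * ((2 * m).choose (m + (k + 1) * (a + 1)) : ℤ) := by
    have h := confinedCount_bridge (Nat.succ_pos a) m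
    rw [confinedCount] at h
    simp only [isConfined_zero_iff _ (Nat.succ_pos a)] at h
    rw [Finset.sum_sub_distrib, Finset.sum_const, card_bridge, Finset.sum_filter]
    simp only [ite_and, Nat.succ_eq_add_one] at h
    rw [h]
    simp
  simp_rw [h1]
  rw [Finset.sum_comm]
  simp only [h2]
  rw [← Finset.mul_sum, Finset.sum_comm]
  simp only [Finset.mul_sum]

/-- The sign pattern of a permutation: the `j`-th step goes up when `σ j < m`. -/
def pattern (m : ℕ) (σ : Equiv.Perm (Fin (2 * m))) : Fin (2 * m) → Bool :=
  fun j => decide ((σ j : ℕ) < m)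

theorem isBridgeFrom_zero_iff {m : ℕ} (s : Fin (2 * m) → Bool) :
    IsBridgeFrom 0 s ↔ Fintype.card {j // s j = true} = m := by
  have h : walk s (2 * m) = 2 * (Fintype.card {j // s j = true} : ℤ) - 2 * m := by
    have h (j : Fin (2 * m)) : (if (j : ℕ) < 2 * m then (if s j then 1 else -1) else 0 : ℤ) =
        2 * (if s j then 1 else 0) - 1 := by
      rw [if_pos j.2]
      split_ifs <;> simp
    rw [walk, Finset.sum_congr rfl fun j _ => h j, Finset.sum_sub_distrib, ← Finset.mul_sum,
      Finset.sum_boole, Fintype.card_subtype]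
    simp
  rw [IsBridgeFrom, h]
  omega

theorem card_fin_lt (m : ℕ) : Fintype.card {j : Fin (2 * m) // (j : ℕ) < m} = m := by
  rw [Fintype.card_subtype]
  rcases Nat.eq_zero_or_pos m with rfl | hm
  · simp
  · have : (Finset.univ.filter fun j : Fin (2 * m) => (j : ℕ) < m) =
        Finset.Iio ⟨m, by omega⟩ := by
      ext j
      simp [Fin.lt_def]
    rw [this, Fin.card_Iio]

theorem isBridgeFrom_pattern {m : ℕ} (σ : Equiv.Perm (Fin (2 * m))) :
    IsBridgeFrom 0 (pattern m σ) := by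
  refine (isBridgeFrom_zero_iff _).2 (Eq.trans ?_ (card_fin_lt m))
  refine Fintype.card_congr (σ.subtypeEquiv fun j => ?_)
  simp [pattern]

theorem exists_pattern_eq {m : ℕ} {s : Fin (2 * m) → Bool} (hs : IsBridgeFrom 0 s) :
    ∃ τ, pattern m τ = s := by
  obtain ⟨e⟩ := Fintype.card_eq.1 (((isBridgeFrom_zero_iff s).1 hs).trans (card_fin_lt m).symm)
  refine ⟨e.extendSubtype, funext fun j => ?_⟩
  by_cases hj : s j = true
  · rw [hj]
    exact decide_eq_true (e.extendSubtype_mem j hj)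
  · rw [Bool.not_eq_true _ |>.mp hj]
    exact decide_eq_false (e.extendSubtype_not_mem j hj)

theorem card_pattern_fiber {m : ℕ} {s : Fin (2 * m) → Bool} (hs : IsBridgeFrom 0 s) :
    (Finset.univ.filter fun σ => pattern m σ = s).card =
      (Finset.univ.filter fun σ => pattern m σ = pattern m 1).card := by
  obtain ⟨τ, rfl⟩ := exists_pattern_eq hs
  refine Finset.card_equiv (Equiv.mulRight τ⁻¹) fun σ => ?_
  simp only [Finset.mem_filter, Finset.mem_univ, true_and, funext_iff]
  rw [← τ.forall_congr_right (q := fun j => pattern m (Equiv.mulRight τ⁻¹ σ) j = pattern m 1 j)]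
  simp only [pattern, decide_eq_decide]
  simp

theorem sum_pattern {R : Type*} [CommSemiring R] (m : ℕ) (f : (Fin (2 * m) → Bool) → R) :
    ∑ σ, f (pattern m σ) = (Finset.univ.filter fun σ => pattern m σ = pattern m 1).card *
      ∑ s with IsBridgeFrom 0 s, f s := by
  rw [← Finset.sum_fiberwise _ (pattern m), Finset.mul_sum, Finset.sum_filter]
  refine Finset.sum_congr rfl fun s _ => ?_
  split_ifs with hs
  · rw [← card_pattern_fiber hs, ← nsmul_eq_mul, ← Finset.sum_const]
    exact Finset.sum_congr rfl fun σ hσ => by rw [(Finset.mem_filter.1 hσ).2]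
  · refine Finset.sum_eq_zero fun σ hσ => absurd (isBridgeFrom_pattern σ) ?_
    rwa [(Finset.mem_filter.1 hσ).2]

/-- The average over permutations is the average over bridges. -/
theorem sum_pattern_div_card (m : ℕ) (f : (Fin (2 * m) → Bool) → ℝ) :
    (∑ σ, f (pattern m σ)) / Fintype.card (Equiv.Perm (Fin (2 * m))) =
      (∑ s with IsBridgeFrom 0 s, f s) / (2 * m).choose m := by
  have h1 := sum_pattern m fun _ => (1 : ℝ)
  rw [Finset.sum_const, Finset.sum_const, card_bridge, Finset.card_univ, nsmul_one, nsmul_one] at h1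
  have hpos : (0 : ℝ) < Fintype.card (Equiv.Perm (Fin (2 * m))) := by
    exact_mod_cast Fintype.card_pos
  rw [h1] at hpos ⊢
  rw [sum_pattern]
  exact mul_div_mul_left _ _ (left_ne_zero_of_mul hpos.ne')

/-- The symmetric tail of the central binomial row, normalized at the centre. -/
noncomputable def chooseRatio (m n : ℕ) : ℝ := (2 * m).choose (m + n) / (2 * m).choose m

theorem average_ks (m : ℕ) :
    (∑ σ : Equiv.Perm (Fin (2 * m)), ks (2 * m) fun j => if ((σ j : ℕ)) < m then (1 : ℝ) else -1)
        / (Fintype.card (Equiv.Perm (Fin (2 * m))) : ℝ) =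
      2 * ∑ k ∈ Finset.range m, (-1) ^ k *
        ∑ a ∈ Finset.range (2 * m), chooseRatio m ((k + 1) * (a + 1)) := by
  have h := sum_pattern_div_card m fun s => (maxWalk s : ℝ)
  simp only [← ks_eq_maxWalk, pattern, decide_eq_true_eq] at h
  rw [h]
  simp only [ks_eq_maxWalk]
  have h2 := congrArg (Int.cast : ℤ → ℝ) (sum_maxWalk_bridge m)
  push_cast at h2
  rw [h2]
  simp only [chooseRatio, ← Finset.sum_div, ← mul_div_assoc]

theorem chooseRatio_nonneg (m n : ℕ) : 0 ≤ chooseRatio m n := by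
  unfold chooseRatio
  positivity

theorem choose_two_mul_ne_zero (m : ℕ) : ((2 * m).choose m : ℝ) ≠ 0 := by
  exact_mod_cast (Nat.choose_pos (by omega)).ne'

theorem chooseRatio_zero (m : ℕ) : chooseRatio m 0 = 1 :=
  div_self (choose_two_mul_ne_zero m)

theorem chooseRatio_eq_zero {m n : ℕ} (h : m < n) : chooseRatio m n = 0 := by
  simp [chooseRatio, Nat.choose_eq_zero_of_lt (show 2 * m < m + n by omega)]

theorem antitone_chooseRatio (m : ℕ) : Antitone (chooseRatio m) := by
  refine antitone_nat_of_succ_le fun n => ?_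
  unfold chooseRatio
  gcongr 1
  have h := Nat.choose_succ_right_eq (2 * m) (m + n)
  have h2 : (2 * m).choose (m + n + 1) * (m + n + 1) ≤ (2 * m).choose (m + n) * (m + n + 1) := by
    rw [h]
    gcongr
    omega
  exact_mod_cast Nat.le_of_mul_le_mul_right h2 (Nat.succ_pos _)

theorem one_add_two_mul_sum_chooseRatio (m : ℕ) :
    1 + 2 * ∑ n ∈ Finset.range m, chooseRatio m (n + 1) = 2 ^ (2 * m) / (2 * m).choose m := by
  have h := Nat.sum_range_choose (2 * m)
  rw [show 2 * m + 1 = m + (m + 1) by ring, Finset.sum_range_add, Finset.sum_range_succ',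
    ← Finset.sum_range_reflect] at h
  have h1 : ∀ n ∈ Finset.range m, (2 * m).choose (m - 1 - n) = (2 * m).choose (m + (n + 1)) := by
    intro n hn
    have hn : n < m := by simpa using hn
    rw [← Nat.choose_symm (by omega)]
    congr 1
    omega
  rw [Finset.sum_congr rfl h1, add_zero] at h
  rw [eq_div_iff (choose_two_mul_ne_zero m)]
  have h2 : (∑ n ∈ Finset.range m, chooseRatio m (n + 1)) * (2 * m).choose m =
      ∑ n ∈ Finset.range m, ((2 * m).choose (m + (n + 1)) : ℝ) := by
    simp only [chooseRatio]
    rw [← Finset.sum_div, div_mul_cancel₀ _ (choose_two_mul_ne_zero m)]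
  have h3 := congrArg (Nat.cast : ℕ → ℝ) h
  push_cast at h3 h2
  rw [← h3, add_mul, mul_assoc, h2]
  ring

theorem Antitone.mul_sum_range_mul_le {f : ℕ → ℝ} (hf : Antitone f) (k A : ℕ) :
    k * ∑ a ∈ Finset.range A, f (k * (a + 1)) ≤ ∑ n ∈ Finset.range (k * A), f (n + 1) := by
  induction A with
  | zero => simp
  | succ A ih =>
    rw [Nat.mul_succ, Finset.sum_range_add _ (k * A), Finset.sum_range_succ _ A, mul_add]
    refine add_le_add ih ?_
    have h := Finset.card_nsmul_le_sum (Finset.range k) (fun j => f (k * A + j + 1))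
      (f (k * (A + 1))) fun j hj => hf ?_
    · simpa using h
    · have : j < k := by simpa using hj
      rw [Nat.mul_succ]
      omega

theorem Antitone.sum_range_le_mul_sum_range_mul {f : ℕ → ℝ} (hf : Antitone f) (k A : ℕ) :
    ∑ n ∈ Finset.range (k * A), f (k + n) ≤ k * ∑ a ∈ Finset.range A, f (k * (a + 1)) := by
  induction A with
  | zero => simp
  | succ A ih =>
    rw [Nat.mul_succ, Finset.sum_range_add _ (k * A), Finset.sum_range_succ _ A, mul_add]
    refine add_le_add ih ?_
    have h := Finset.sum_le_card_nsmul (Finset.range k) (fun j => f (k + (k * A + j)))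
      (f (k * (A + 1))) fun j _ => hf ?_
    · simpa using h
    · rw [Nat.mul_succ]
      omega

theorem sum_chooseRatio_mul_le (m : ℕ) {k : ℕ} (hk : 0 < k) :
    k * ∑ a ∈ Finset.range (2 * m), chooseRatio m (k * (a + 1)) ≤
      ∑ n ∈ Finset.range m, chooseRatio m (n + 1) := by
  refine ((antitone_chooseRatio m).mul_sum_range_mul_le k (2 * m)).trans_eq ?_
  refine (Finset.sum_subset (Finset.range_mono (by nlinarith)) fun n _ hn => ?_).symm
  exact chooseRatio_eq_zero (by simpa [Nat.lt_succ_iff] using hn)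

theorem le_sum_chooseRatio_mul (m : ℕ) {k : ℕ} (hk : 0 < k) :
    ∑ n ∈ Finset.range m, chooseRatio m (n + 1) - k ≤
      k * ∑ a ∈ Finset.range (2 * m), chooseRatio m (k * (a + 1)) := by
  have h1 := (antitone_chooseRatio m).sum_range_le_mul_sum_range_mul k (2 * m)
  have h2 : ∑ n ∈ Finset.range k, chooseRatio m n ≤ k := by
    refine (Finset.sum_le_card_nsmul _ _ 1 fun n _ => ?_).trans_eq (by simp)
    exact (antitone_chooseRatio m (Nat.zero_le n)).trans_eq (chooseRatio_zero m)
  have h3 : ∑ n ∈ Finset.range m, chooseRatio m (n + 1) ≤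
      ∑ n ∈ Finset.range (k + k * (2 * m)), chooseRatio m n := by
    calc ∑ n ∈ Finset.range m, chooseRatio m (n + 1)
        ≤ ∑ n ∈ Finset.range (m + 1), chooseRatio m n := by
          rw [Finset.sum_range_succ']
          linarith [chooseRatio_nonneg m 0]
      _ ≤ _ := Finset.sum_le_sum_of_subset_of_nonneg (Finset.range_mono (by nlinarith))
          fun n _ _ => chooseRatio_nonneg m n
  rw [Finset.sum_range_add] at h3
  linarith

theorem tendsto_sqrt_two_mul : Filter.Tendsto (fun m : ℕ => √(2 * m : ℝ)) Filter.atTop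
    Filter.atTop :=
  Real.tendsto_sqrt_atTop.comp
    (tendsto_natCast_atTop_atTop.const_mul_atTop (by norm_num : (0 : ℝ) < 2))

theorem tendsto_two_pow_div_choose :
    Filter.Tendsto (fun m : ℕ => 2 ^ (2 * m) / ((2 * m).choose m : ℝ) / √(2 * m))
      Filter.atTop (nhds √(Real.pi / 2)) := by
  have hW (m : ℕ) : (2 ^ (2 * m) / ((2 * m).choose m : ℝ)) ^ 2 = Real.Wallis.W m * (2 * m + 1) := by
    rw [Real.Wallis.W_eq_factorial_ratio, Nat.cast_choose ℝ (by omega : m ≤ 2 * m),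
      show 2 * m - m = m by omega]
    have := Nat.factorial_pos m
    have := Nat.factorial_pos (2 * m)
    field_simp
    ring
  have hinv : Filter.Tendsto (fun m : ℕ => 1 + ((2 : ℝ) * m)⁻¹) Filter.atTop (nhds (1 + 0)) :=
    (tendsto_inv_atTop_zero.comp
      (tendsto_natCast_atTop_atTop.const_mul_atTop (by norm_num : (0 : ℝ) < 2))).const_add 1
  have h := (Real.Wallis.tendsto_W_nhds_pi_div_two.mul hinv).sqrt
  rw [add_zero, mul_one] at h
  refine h.congr' ?_
  filter_upwards [Filter.eventually_gt_atTop 0] with m hm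
  have hm : (0 : ℝ) < m := by exact_mod_cast hm
  rw [show 1 + ((2 : ℝ) * m)⁻¹ = (2 * m + 1) / (2 * m) by field_simp, ← mul_div_assoc, ← hW,
    Real.sqrt_div (sq_nonneg _), Real.sqrt_sq (by positivity)]

theorem tendsto_sum_chooseRatio :
    Filter.Tendsto (fun m : ℕ => 2 * (∑ n ∈ Finset.range m, chooseRatio m (n + 1)) / √(2 * m))
      Filter.atTop (nhds √(Real.pi / 2)) := by
  have h := tendsto_two_pow_div_choose.sub (tendsto_inv_atTop_zero.comp tendsto_sqrt_two_mul)
  rw [sub_zero] at h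
  refine h.congr fun m => ?_
  rw [← one_add_two_mul_sum_chooseRatio, Function.comp_apply]
  ring

theorem tendsto_sum_chooseRatio_mul (k : ℕ) :
    Filter.Tendsto (fun m : ℕ =>
        2 * (∑ a ∈ Finset.range (2 * m), chooseRatio m ((k + 1) * (a + 1))) / √(2 * m))
      Filter.atTop (nhds (√(Real.pi / 2) * (1 / (k + 1)))) := by
  have hk : (0 : ℝ) < k + 1 := by positivity
  have hup := tendsto_sum_chooseRatio.mul_const (1 / ((k : ℝ) + 1))
  have hlow := hup.sub ((tendsto_inv_atTop_zero.comp tendsto_sqrt_two_mul).const_mul 2)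
  rw [mul_zero, sub_zero] at hlow
  refine tendsto_of_tendsto_of_tendsto_of_le_of_le hlow hup (fun m => ?_) fun m => ?_
  · have h := le_sum_chooseRatio_mul m (Nat.succ_pos k)
    have h0 : 0 ≤ (√(2 * m : ℝ))⁻¹ := by positivity
    push_cast [Nat.succ_eq_add_one] at h
    have h' : (∑ n ∈ Finset.range m, chooseRatio m (n + 1)) * (1 / ((k : ℝ) + 1)) - 1 ≤
        ∑ a ∈ Finset.range (2 * m), chooseRatio m ((k + 1) * (a + 1)) := by
      rw [mul_one_div, sub_le_iff_le_add, div_le_iff₀ hk]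
      linarith
    simp only [Function.comp_apply, div_eq_mul_inv _ √_]
    nlinarith
  · have h := sum_chooseRatio_mul_le m (Nat.succ_pos k)
    push_cast [Nat.succ_eq_add_one] at h
    rw [div_mul_eq_mul_div, mul_assoc 2]
    gcongr
    rw [mul_one_div, le_div_iff₀ hk]
    linarith

theorem Antitone.alternating_sum_mem_Icc {f : ℕ → ℝ} (hf : Antitone f) (h0 : ∀ n, 0 ≤ f n)
    (n : ℕ) : ∑ k ∈ Finset.range n, (-1) ^ k * f k ∈ Set.Icc 0 (f 0) := by
  induction n generalizing f with
  | zero => simpa using h0 0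
  | succ n ih =>
    have h := ih (f := fun k => f (k + 1)) (fun a b hab => hf (by omega)) fun k => h0 (k + 1)
    have h1 : f (0 + 1) ≤ f 0 := hf (by omega)
    have h2 : ∑ k ∈ Finset.range n, (-1) ^ (k + 1) * f (k + 1) =
        -∑ k ∈ Finset.range n, (-1) ^ k * f (k + 1) := by
      rw [← Finset.sum_neg_distrib]
      exact Finset.sum_congr rfl fun k _ => by ring
    rw [Finset.sum_range_succ', h2]
    simp only [Set.mem_Icc] at h ⊢
    constructor <;> linarith [h.1, h.2]

theorem Antitone.abs_alternating_sum_sub_le {f : ℕ → ℝ} (hf : Antitone f) (h0 : ∀ n, 0 ≤ f n)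
    {K n : ℕ} (hKn : K ≤ n) :
    |∑ k ∈ Finset.range n, (-1) ^ k * f k - ∑ k ∈ Finset.range K, (-1) ^ k * f k| ≤ f K := by
  obtain ⟨d, rfl⟩ := Nat.exists_eq_add_of_le hKn
  have h := Antitone.alternating_sum_mem_Icc (f := fun k => f (K + k))
    (fun a b hab => hf (by omega)) (fun k => h0 (K + k)) d
  rw [Finset.sum_range_add, add_sub_cancel_left]
  simp only [pow_add, mul_assoc]
  rw [← Finset.mul_sum, abs_mul, abs_pow, abs_neg, abs_one, one_pow, one_mul, abs_of_nonneg h.1]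
  exact h.2

/-- Termwise passage to the limit in alternating sums of antitone sequences. -/
theorem tendsto_alternating_sum_of_antitone {g : ℕ → ℕ → ℝ} {l : ℕ → ℝ} {L : ℝ}
    (hg : ∀ m, Antitone (g m)) (h0 : ∀ m k, 0 ≤ g m k)
    (hgl : ∀ k, Filter.Tendsto (fun m => g m k) Filter.atTop (nhds (l k)))
    (hl : Filter.Tendsto l Filter.atTop (nhds 0))
    (hL : Filter.Tendsto (fun K => ∑ k ∈ Finset.range K, (-1) ^ k * l k) Filter.atTop (nhds L)) :
    Filter.Tendsto (fun m => ∑ k ∈ Finset.range m, (-1) ^ k * g m k) Filter.atTop (nhds L) := by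
  rw [Metric.tendsto_nhds]
  intro ε hε
  obtain ⟨K, hK1, hK2⟩ := ((hl.eventually_lt_const (by positivity : 0 < ε / 3)).and
    (Metric.tendsto_nhds.1 hL (ε / 3) (by positivity))).exists
  have hsum : Filter.Tendsto (fun m => ∑ k ∈ Finset.range K, (-1) ^ k * g m k) Filter.atTop
      (nhds (∑ k ∈ Finset.range K, (-1) ^ k * l k)) :=
    tendsto_finsetSum _ fun k _ => (hgl k).const_mul _
  filter_upwards [(hgl K).eventually_lt_const hK1,
    Metric.tendsto_nhds.1 hsum (ε / 3) (by positivity), Filter.eventually_ge_atTop K]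
    with m h1 h2 hm
  have h3 := (hg m).abs_alternating_sum_sub_le (h0 m) hm
  rw [Real.dist_eq, abs_lt] at *
  rw [abs_le] at h3
  constructor <;> linarith [h2.1, h2.2, h3.1, h3.2, hK2.1, hK2.2]

theorem alternating_harmonic_two_mul (N : ℕ) :
    ∑ k ∈ Finset.range (2 * N), (-1 : ℝ) ^ k * (1 / (k + 1)) =
      (harmonic (2 * N) : ℝ) - harmonic N := by
  induction N with
  | zero => simp
  | succ N ih =>
    rw [show 2 * (N + 1) = 2 * N + 1 + 1 by ring, Finset.sum_range_succ, Finset.sum_range_succ, ih,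
      harmonic_succ, harmonic_succ, harmonic_succ, pow_succ, pow_mul]
    push_cast
    field_simp
    ring

theorem tendsto_alternating_harmonic :
    Filter.Tendsto (fun K => ∑ k ∈ Finset.range K, (-1 : ℝ) ^ k * (1 / (k + 1)))
      Filter.atTop (nhds (Real.log 2)) := by
  obtain ⟨l, hl⟩ := Antitone.tendsto_alternating_series_of_tendsto_zero
    (f := fun k : ℕ => 1 / ((k : ℝ) + 1)) (fun a b hab => by dsimp only; gcongr)
    tendsto_one_div_add_atTop_nhds_zero_nat
  have h2 : Filter.Tendsto (fun N : ℕ => 2 * N) Filter.atTop Filter.atTop :=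
    Filter.tendsto_id.const_mul_atTop' (by norm_num)
  have h := ((Real.tendsto_harmonic_sub_log.comp h2).sub Real.tendsto_harmonic_sub_log).add_const
    (Real.log 2)
  rw [sub_self, zero_add] at h
  have heq : l = Real.log 2 := by
    refine tendsto_nhds_unique (hl.comp h2) (h.congr' ?_)
    filter_upwards [Filter.eventually_gt_atTop 0] with N hN
    have hN : (N : ℝ) ≠ 0 := by exact_mod_cast hN.ne'
    simp only [Function.comp_apply]
    rw [alternating_harmonic_two_mul]
    push_cast
    rw [Real.log_mul two_ne_zero hN]
    ring
  rwa [← heq]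

theorem expected_ks_random_bridge_tendsto :
    Filter.Tendsto
      (fun m : ℕ =>
        (∑ σ : Equiv.Perm (Fin (2 * m)),
            ks (2 * m) fun j => if ((σ j : ℕ)) < m then (1 : ℝ) else -1)
          / (Fintype.card (Equiv.Perm (Fin (2 * m))) : ℝ)
          / Real.sqrt (2 * m))
      Filter.atTop
      (nhds (Real.sqrt (Real.pi / 2) * Real.log 2)) := by
  have h := tendsto_alternating_sum_of_antitone
    (g := fun m k =>
      2 * (∑ a ∈ Finset.range (2 * m), chooseRatio m ((k + 1) * (a + 1))) / √(2 * m))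
    (l := fun k => √(Real.pi / 2) * (1 / (k + 1))) (L := √(Real.pi / 2) * Real.log 2)
    (fun m j k hjk => ?_) (fun m k => ?_) tendsto_sum_chooseRatio_mul ?_ ?_
  · refine h.congr fun m => ?_
    rw [average_ks, Finset.mul_sum, Finset.sum_div]
    exact Finset.sum_congr rfl fun k _ => by ring
  · dsimp only
    gcongr 2 * ?_ / _
    refine Finset.sum_le_sum fun a _ => antitone_chooseRatio m ?_
    gcongr
  · have := Finset.sum_nonneg fun a (_ : a ∈ Finset.range (2 * m)) =>
      chooseRatio_nonneg m ((k + 1) * (a + 1))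
    positivity
  · simpa using tendsto_one_div_add_atTop_nhds_zero_nat.const_mul √(Real.pi / 2)
  · refine (tendsto_alternating_harmonic.const_mul √(Real.pi / 2)).congr fun K => ?_
    rw [Finset.mul_sum]
    exact Finset.sum_congr rfl fun k _ => by ring
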